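/- arXiv:2102.09385 — 4 statements merged into one kernel-verified Lean document; each statement's English description precedes it below -/
import Mathlib

section
/- Let F : ℝ^d → ℝ be a Łojasiewicz function with gradient f = ∇F, and let K ⊂ ℝ^d be a compact set. Then the set of critical levels 𝓛_K = {F(x) : x ∈ K, f(x) = 0} is a finite set. -/
open Set

/-- Dereich–Kassing, Lemma 3.8 (1).
For a Łojasiewicz function `F` and a compact set `K`, the set of critical
levels `𝓛_K = {F(x) : x ∈ K, ∇F(x) = 0}` is finite. -/
theorem lojasiewicz_critical_levels_finite
    {d : ℕ} (F : EuclideanSpace ℝ (Fin d) → ℝ)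
    (f : EuclideanSpace ℝ (Fin d) → EuclideanSpace ℝ (Fin d))
    (hF : ContDiff ℝ 1 F) (hf : f = gradient F)
    (hLip : LocallyLipschitz f)
    (hLoja : ∀ x, f x = 0 → ∃ U ∈ nhds x, ∃ CL : ℝ, 0 < CL ∧ ∃ β ∈ Set.Ico (1/2 : ℝ) 1,
      ∀ y ∈ U, CL * |F y - F x| ^ β ≤ ‖f y‖)
    (K : Set (EuclideanSpace ℝ (Fin d))) (hK : IsCompact K) :
    {r : ℝ | ∃ x ∈ K, f x = 0 ∧ F x = r}.Finite := by
  have hcrit : IsCompact (K ∩ f ⁻¹' {0}) :=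
    hK.inter_right (isClosed_singleton.preimage hLip.continuous)
  have hfin : (F '' ((K ∩ f ⁻¹' {0}) ∩ f ⁻¹' {0})).Finite := by
    refine hcrit.induction_on (p := fun s => (F '' (s ∩ f ⁻¹' {0})).Finite) ?_ ?_ ?_ ?_
    · simp
    · intro s t hst ht
      exact ht.subset (image_mono (inter_subset_inter_left _ hst))
    · intro s t hs ht
      rw [union_inter_distrib_right, image_union]
      exact hs.union ht
    · rintro x ⟨-, hx⟩
      obtain ⟨U, hU, CL, hCL, β, -, h⟩ := hLoja x hx
      refine ⟨U, mem_nhdsWithin_of_mem_nhds hU, (finite_singleton (F x)).subset ?_⟩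
      rintro _ ⟨y, ⟨hyU, hy⟩, rfl⟩
      have hy0 : f y = 0 := hy
      have hle := h y hyU
      rw [hy0, norm_zero] at hle
      by_contra hne
      have hpos : 0 < |F y - F x| := abs_pos.mpr (sub_ne_zero.mpr hne)
      exact absurd hle (not_le.mpr (mul_pos hCL (Real.rpow_pos_of_pos hpos β)))
  refine hfin.subset ?_
  rintro r ⟨x, hxK, hx, rfl⟩
  exact ⟨x, ⟨⟨hxK, hx⟩, hx⟩, rfl⟩
end

section
/- Let F : ℝ^d → ℝ be a Łojasiewicz function with gradient f = ∇F, let K ⊂ ℝ^d be a compact set, and let ℓ be a critical level of F on K (i.e. ℓ = F(x) for some x ∈ K with f(x) = 0). Then there exist an open set U ⊇ F^{−1}({ℓ}) ∩ K, a constant C_L > 0 and β ∈ [1/2, 1) such that |f(y)| ≥ C_L |F(y) − ℓ|^β for every y ∈ U. -/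
open Set

/-- On a set where `|g| ≤ 1`, inequalities `C * |g| ^ β ≤ h` holding near each point of a compact set
can be made uniform in `C` and `β` on an open neighbourhood of the compact set. -/
theorem IsCompact.exists_open_uniform_lojasiewicz {X : Type*} [TopologicalSpace X]
    {g h : X → ℝ} {S : Set X} (hS : IsCompact S)
    (hloc : ∀ x ∈ S, ∃ V ∈ nhds x, ∃ C : ℝ, 0 < C ∧ ∃ β ∈ Set.Ico (1/2 : ℝ) 1,
      ∀ y ∈ V, |g y| ≤ 1 ∧ C * |g y| ^ β ≤ h y) :
    ∃ U : Set X, IsOpen U ∧ S ⊆ U ∧ ∃ C : ℝ, 0 < C ∧ ∃ β ∈ Set.Ico (1/2 : ℝ) 1,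
      ∀ y ∈ U, |g y| ≤ 1 ∧ C * |g y| ^ β ≤ h y := by
  have weaken : ∀ {C C' β β' a b : ℝ}, 0 < C' → C' ≤ C → 1/2 ≤ β → β ≤ β' → 0 ≤ a → a ≤ 1 →
      C * a ^ β ≤ b → C' * a ^ β' ≤ b := by
    intro C C' β β' a b hC' hCC hβ hββ ha ha1 hab
    have hpow : a ^ β' ≤ a ^ β :=
      Real.rpow_le_rpow_of_exponent_ge_of_imp ha ha1 hββ (fun _ h0 => by linarith)
    exact (mul_le_mul hCC hpow (by positivity) (hC'.le.trans hCC)).trans hab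
  refine hS.induction_on
    (p := fun s => ∃ U : Set X, IsOpen U ∧ s ⊆ U ∧ ∃ C : ℝ, 0 < C ∧ ∃ β ∈ Set.Ico (1/2 : ℝ) 1,
      ∀ y ∈ U, |g y| ≤ 1 ∧ C * |g y| ^ β ≤ h y) ?_ ?_ ?_ ?_
  · exact ⟨∅, isOpen_empty, subset_rfl, 1, one_pos, 1/2, by norm_num, by simp⟩
  · rintro s t hst ⟨U, hU, htU, H⟩
    exact ⟨U, hU, hst.trans htU, H⟩
  · rintro s t ⟨U, hU, hsU, C, hC, β, hβ, H⟩ ⟨V, hV, htV, D, hD, γ, hγ, H'⟩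
    refine ⟨U ∪ V, hU.union hV, union_subset_union hsU htV, min C D, lt_min hC hD, max β γ,
      ⟨hβ.1.trans (le_max_left _ _), max_lt hβ.2 hγ.2⟩, ?_⟩
    rintro y (hy | hy)
    · exact ⟨(H y hy).1, weaken (lt_min hC hD) (min_le_left _ _) hβ.1 (le_max_left _ _)
        (abs_nonneg _) (H y hy).1 (H y hy).2⟩
    · exact ⟨(H' y hy).1, weaken (lt_min hC hD) (min_le_right _ _) hγ.1 (le_max_right _ _)
        (abs_nonneg _) (H' y hy).1 (H' y hy).2⟩
  · intro x hx
    obtain ⟨V, hV, H⟩ := hloc x hx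
    obtain ⟨W, hWV, hW, hxW⟩ := mem_nhds_iff.1 hV
    obtain ⟨C, hC, β, hβ, H⟩ := H
    exact ⟨W, mem_nhdsWithin_of_mem_nhds (hW.mem_nhds hxW), W, hW, subset_rfl, C, hC, β, hβ,
      fun y hy => H y (hWV hy)⟩

/-- Dereich–Kassing, Lemma 3.8 (2).
For a Łojasiewicz function `F`, a compact set `K` and a critical level `ℓ`
of `F` on `K`, there is an open neighbourhood `U ⊇ F⁻¹({ℓ}) ∩ K` on which a
Łojasiewicz inequality `C_L |F(y) - ℓ|^β ≤ ‖∇F(y)‖` holds. -/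
theorem lojasiewicz_inequality_around_critical_level
    {d : ℕ} (F : EuclideanSpace ℝ (Fin d) → ℝ)
    (f : EuclideanSpace ℝ (Fin d) → EuclideanSpace ℝ (Fin d))
    (hF : ContDiff ℝ 1 F) (hf : f = gradient F)
    (hLip : LocallyLipschitz f)
    (hLoja : ∀ x, f x = 0 → ∃ U ∈ nhds x, ∃ CL : ℝ, 0 < CL ∧ ∃ β ∈ Set.Ico (1/2 : ℝ) 1,
      ∀ y ∈ U, CL * |F y - F x| ^ β ≤ ‖f y‖)
    (K : Set (EuclideanSpace ℝ (Fin d))) (hK : IsCompact K)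
    (ℓ : ℝ) (hℓ : ∃ x ∈ K, f x = 0 ∧ F x = ℓ) :
    ∃ U : Set (EuclideanSpace ℝ (Fin d)), IsOpen U ∧ F ⁻¹' {ℓ} ∩ K ⊆ U ∧
      ∃ CL : ℝ, 0 < CL ∧ ∃ β ∈ Set.Ico (1/2 : ℝ) 1,
        ∀ y ∈ U, CL * |F y - ℓ| ^ β ≤ ‖f y‖ := by
  have hcompact : IsCompact (F ⁻¹' {ℓ} ∩ K) :=
    hK.inter_left (isClosed_singleton.preimage hF.continuous)
  obtain ⟨U, hU, hSU, C, hC, β, hβ, H⟩ := hcompact.exists_open_uniform_lojasiewicz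
    (g := fun y => F y - ℓ) (h := fun y => ‖f y‖) (by
      rintro x ⟨hxℓ, -⟩
      obtain rfl : F x = ℓ := hxℓ
      have hsmall : ∀ᶠ y in nhds x, |F y - F x| < 1 :=
        (hF.continuous.sub continuous_const).abs.continuousAt.eventually_lt_const (by simp)
      by_cases hfx : f x = 0
      · obtain ⟨V, hV, C, hC, β, hβ, H⟩ := hLoja x hfx
        exact ⟨_, Filter.inter_mem hV hsmall, C, hC, β, hβ,
          fun y hy => ⟨(show |F y - F x| < 1 from hy.2).le, H y hy.1⟩⟩
      · have hpos : 0 < ‖f x‖ := norm_pos_iff.2 hfx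
        have hlarge : ∀ᶠ y in nhds x, ‖f x‖ / 2 < ‖f y‖ :=
          hLip.continuous.norm.continuousAt.eventually_const_lt (half_lt_self hpos)
        refine ⟨_, hsmall.and hlarge, ‖f x‖ / 2, half_pos hpos, 1/2, by norm_num, ?_⟩
        rintro y ⟨hy1, hy2⟩
        refine ⟨hy1.le, le_trans ?_ hy2.le⟩
        exact mul_le_of_le_one_right (half_pos hpos).le
          (Real.rpow_le_one (abs_nonneg _) hy1.le (by norm_num)))
  exact ⟨U, hU, hSU, C, hC, β, hβ, fun y hy => (H y hy).2⟩
end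

section
/- Let ρ : ℝ → ℝ and 𝓛 : ℝ^{d_out} × ℝ^{d_out} → ℝ be analytic functions, and let X and Y be random variables on a probability space taking values in ℝ^{d_in} and ℝ^{d_out} respectively, each supported on a compact set. Then the function F : 𝒫_N → ℝ, Θ ↦ E[𝓛(𝓡_N(Θ, X), Y)], is analytic. -/
open MeasureTheory Set

/-- The realization of a feed-forward neural network with architecture
`Narch : ℕ → ℕ`, activation function `ρ`, weight matrices `A` and biases `b`. -/
noncomputable def netRealization (Narch : ℕ → ℕ) (ρ : ℝ → ℝ)
    (A : (ℓ : ℕ) → Fin (Narch (ℓ + 1)) → Fin (Narch ℓ) → ℝ)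
    (b : (ℓ : ℕ) → Fin (Narch (ℓ + 1)) → ℝ) :
    (k : ℕ) → (Fin (Narch 0) → ℝ) → Fin (Narch k) → ℝ
  | 0 => fun x => x
  | (k + 1) => fun x i =>
      (∑ j, A k i j *
        (if k = 0 then netRealization Narch ρ A b k x j
          else ρ (netRealization Narch ρ A b k x j))) + b k i

open Filter Topology
open scoped ENNReal NNReal

section ParametricIntegral

variable {E F H : Type*} [NormedAddCommGroup E] [NormedSpace ℝ E]
  [NormedAddCommGroup F] [NormedSpace ℝ F] [NormedAddCommGroup H] [NormedSpace ℝ H]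

/-- On a ball around the origin, the recentred series `p.changeOrigin y` satisfy summable Cauchy
estimates that are uniform in `y`. -/
theorem FormalMultilinearSeries.exists_summable_bound_changeOrigin
    (p : FormalMultilinearSeries ℝ E F) {r s : ℝ≥0} (h : (r + s : ℝ≥0∞) < p.radius) :
    ∃ C : ℕ → ℝ, Summable C ∧
      ∀ y : E, ‖y‖₊ ≤ r → ∀ n, ‖p.changeOrigin y n‖ * (s : ℝ) ^ n ≤ C n := by
  have hs := p.changeOriginSeries_summable_aux₁ h
  refine ⟨fun n => ((∑' t : Σ l : ℕ, { s : Finset (Fin (n + l)) // s.card = l },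
      ‖p (n + t.1)‖₊ * r ^ t.1 * s ^ n : ℝ≥0) : ℝ),
    NNReal.summable_coe.2 (NNReal.summable_sigma.1 hs).2, fun y hy n => ?_⟩
  have hr : (r : ℝ≥0∞) < p.radius := (le_add_right le_rfl).trans_lt h
  have hy' : (‖y‖₊ : ℝ≥0∞) < p.radius := lt_of_le_of_lt (by exact_mod_cast hy) hr
  simp only [NNReal.tsum_mul_right]
  refine mod_cast mul_le_mul_left ((p.nnnorm_changeOrigin_le n hy').trans ?_) (s ^ n)
  refine Summable.tsum_le_tsum (fun t => ?_) (p.changeOriginSeries_summable_aux₂ hy' n)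
    (p.changeOriginSeries_summable_aux₂ hr n)
  gcongr

/-- Integrating a family of power series with uniform summable Cauchy estimates. -/
theorem hasFPowerSeriesOnBall_integral {α : Type*} [MeasurableSpace α] {μ : Measure α}
    [IsFiniteMeasure μ] [CompleteSpace H] {f : E → α → H} {q : α → FormalMultilinearSeries ℝ E H}
    {x : E} {r : ℝ≥0} (hr : 0 < r) {C : ℕ → ℝ} (hC : Summable C)
    (hint : ∀ n, Integrable (fun a => q a n) μ)
    (hbound : ∀ᵐ a ∂μ, ∀ n, ‖q a n‖ * (r : ℝ) ^ n ≤ C n)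
    (hsum : ∀ᵐ a ∂μ, ∀ y : E, ‖y‖₊ < r → HasSum (fun n => q a n fun _ => y) (f (x + y) a)) :
    HasFPowerSeriesOnBall (fun y => ∫ a, f y a ∂μ) (fun n => ∫ a, q a n ∂μ) x r where
  r_le := by
    refine FormalMultilinearSeries.le_radius_of_summable _ ?_
    refine Summable.of_nonneg_of_le (fun n => by positivity) (fun n => ?_)
      (hC.mul_right (μ.real Set.univ))
    have hle : ∀ᵐ a ∂μ, ‖(r : ℝ) ^ n • q a n‖ ≤ C n := by
      filter_upwards [hbound] with a ha
      rw [norm_smul, mul_comm, norm_pow, NNReal.norm_eq]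
      exact ha n
    have := norm_integral_le_of_norm_le_const hle
    rwa [integral_smul, norm_smul, mul_comm, norm_pow, NNReal.norm_eq] at this
  r_pos := by exact_mod_cast hr
  hasSum := by
    intro y hy
    have hy' : ‖y‖₊ < r := by
      rw [mem_eball_zero_iff] at hy
      exact ENNReal.coe_lt_coe.1 hy
    have happ : ∀ n, (∫ a, q a n ∂μ) (fun _ => y) = ∫ a, q a n (fun _ => y) ∂μ := fun n =>
      ContinuousMultilinearMap.integral_apply (hint n) _
    simp only [happ]
    refine hasSum_integral_of_dominated_convergence (fun n _ => C n) (fun n => ?_) (fun n => ?_)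
      (Eventually.of_forall fun _ => hC) (integrable_const _) ?_
    · exact ((ContinuousMultilinearMap.apply ℝ (fun _ : Fin n => E) H
        fun _ => y).integrable_comp (hint n)).1
    · filter_upwards [hbound] with a ha
      refine ((q a n).le_opNorm _).trans (le_trans ?_ (ha n))
      rw [Finset.prod_const, Finset.card_univ, Fintype.card_fin]
      gcongr
      exact_mod_cast hy'.le
    · filter_upwards [hsum] with a ha using ha y hy'

variable [ProperSpace F] [MeasurableSpace F] [BorelSpace F] [CompleteSpace H]

/-- Local version of `analyticAt_integral_of_isCompact`. -/
theorem AnalyticAt.exists_closedBall_analyticAt_setIntegral {G : E × F → H} {θ : E} {z : F}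
    (hG : AnalyticAt ℝ G (θ, z)) :
    ∃ ε > 0, ∀ ν : Measure F, IsFiniteMeasure ν →
      AnalyticAt ℝ (fun θ' => ∫ w in Metric.closedBall z ε, G (θ', w) ∂ν) θ := by
  obtain ⟨p, R, hp⟩ := hG
  obtain ⟨R', hR', hR'R⟩ := ENNReal.lt_iff_exists_nnreal_btwn.1 hp.r_pos
  obtain ⟨s, hs⟩ : ∃ s : ℝ≥0, s = R' / 2 := ⟨_, rfl⟩
  have hR'0 : 0 < R' := by exact_mod_cast hR'
  have hs0 : 0 < s := by rw [hs]; positivity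
  have hss : s + s = R' := by rw [hs]; exact add_halves R'
  have hsR : (s + s : ℝ≥0∞) < R := by
    rw [← ENNReal.coe_add, hss]; exact hR'R
  have hsR1 : (s : ℝ≥0∞) < R := (le_add_right le_rfl).trans_lt hsR
  obtain ⟨C, hC, hCb⟩ := p.exists_summable_bound_changeOrigin (hsR.trans_le hp.r_le)
  refine ⟨s, by exact_mod_cast hs0, fun ν _ => ?_⟩
  have hnorm : ∀ w ∈ Metric.closedBall z (s : ℝ), ‖((0 : E), w - z)‖₊ ≤ s := by
    intro w hw
    rw [Prod.nnnorm_mk, nnnorm_zero]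
    refine max_le zero_le ?_
    rw [mem_closedBall_iff_norm] at hw
    exact_mod_cast hw
  refine (hasFPowerSeriesOnBall_integral (r := s) (C := C)
    (q := fun w => (p.changeOrigin (0, w - z)).compContinuousLinearMap
      (ContinuousLinearMap.inl ℝ E F)) hs0 hC (fun n => ?_) ?_ ?_).analyticAt
  · refine ContinuousOn.integrableOn_compact (isCompact_closedBall _ _) ?_
    refine (ContinuousMultilinearMap.compContinuousLinearMapL (F := H)
      (fun _ : Fin n => ContinuousLinearMap.inl ℝ E F)).continuous.comp_continuousOn ?_
    refine (p.hasFPowerSeriesOnBall_changeOrigin n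
      (hp.r_pos.trans_le hp.r_le)).continuousOn.comp (by fun_prop) fun w hw => ?_
    rw [mem_eball_zero_iff]
    exact lt_of_le_of_lt (by exact_mod_cast hnorm w hw) (hsR1.trans_le hp.r_le)
  · filter_upwards [ae_restrict_mem Metric.isClosed_closedBall.measurableSet] with w hw n
    refine le_trans ?_ (hCb _ (hnorm w hw) n)
    gcongr
    refine (ContinuousMultilinearMap.norm_compContinuousLinearMap_le _ _).trans ?_
    refine mul_le_of_le_one_right (norm_nonneg _) (Finset.prod_le_one (fun _ _ => norm_nonneg _)
      fun _ _ => ContinuousLinearMap.norm_inl_le_one ℝ E F)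
  · filter_upwards [ae_restrict_mem Metric.isClosed_closedBall.measurableSet] with w hw y hy
    have hw' : (‖((0 : E), w - z)‖₊ : ℝ≥0∞) ≤ s := by exact_mod_cast hnorm w hw
    have key := (hp.changeOrigin (hw'.trans_lt hsR1)).hasSum (y := (y, 0)) (by
      rw [mem_eball_zero_iff, lt_tsub_iff_left]
      have : ‖(y, (0 : F))‖ₑ ≤ s := by
        rw [enorm_le_coe, Prod.nnnorm_mk, nnnorm_zero]
        exact max_le hy.le zero_le
      exact (add_le_add hw' this).trans_lt hsR)
    simpa [Function.comp_def] using key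

/-- The integral of a jointly analytic function against a finite measure carried by a compact set
is analytic in the parameter. -/
theorem analyticAt_integral_of_isCompact {G : E × F → H} (hG : ∀ v, AnalyticAt ℝ G v)
    {K : Set F} (hK : IsCompact K) {μ : Measure F} [IsFiniteMeasure μ]
    (hμ : ∀ᵐ z ∂μ, z ∈ K) (θ : E) : AnalyticAt ℝ (fun θ' => ∫ z, G (θ', z) ∂μ) θ := by
  have hcont : Continuous G := continuous_iff_continuousAt.2 fun v => (hG v).continuousAt
  have hint : ∀ (U : Set F) (ν : Measure F) [IsFiniteMeasure ν], Bornology.IsBounded U →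
      ∀ θ', IntegrableOn (fun z => G (θ', z)) U ν := fun U ν _ hU θ' =>
    (ContinuousOn.integrableOn_compact hU.isCompact_closure
      (by fun_prop)).mono_set subset_closure
  obtain ⟨U, hKU, -, -, hU⟩ : ∃ U, K ⊆ U ∧ MeasurableSet U ∧ Bornology.IsBounded U ∧
      ∀ ν : Measure F, IsFiniteMeasure ν →
        AnalyticAt ℝ (fun θ' => ∫ z in U, G (θ', z) ∂ν) θ := by
    refine hK.induction_on
      (p := fun S => ∃ U, S ⊆ U ∧ MeasurableSet U ∧ Bornology.IsBounded U ∧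
        ∀ ν : Measure F, IsFiniteMeasure ν →
          AnalyticAt ℝ (fun θ' => ∫ z in U, G (θ', z) ∂ν) θ) ?_ ?_ ?_ ?_
    · exact ⟨∅, subset_rfl, .empty, Bornology.isBounded_empty, fun ν _ => by
        simpa using analyticAt_const⟩
    · rintro S T hST ⟨U, hTU, hU⟩
      exact ⟨U, hST.trans hTU, hU⟩
    · rintro S T ⟨U, hSU, hUm, hUb, hU⟩ ⟨V, hTV, hVm, hVb, hV⟩
      refine ⟨U ∪ V, union_subset_union hSU hTV, hUm.union hVm, hUb.union hVb, fun ν _ => ?_⟩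
      have heq : (fun θ' => ∫ z in U ∪ V, G (θ', z) ∂ν) = fun θ' =>
          ∫ z in U, G (θ', z) ∂ν + ∫ z in V, G (θ', z) ∂(ν.restrict Uᶜ) := by
        funext θ'
        rw [Measure.restrict_restrict hVm, ← sdiff_eq, ← union_sdiff_self,
          setIntegral_union disjoint_sdiff_right (hVm.diff hUm) (hint U ν hUb θ')
            (hint (V \ U) ν (hVb.subset sdiff_subset) θ')]
      rw [heq]
      exact (hU ν inferInstance).add (hV _ inferInstance)
    · intro z _
      obtain ⟨ε, hε, h⟩ := (hG (θ, z)).exists_closedBall_analyticAt_setIntegral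
      exact ⟨_, mem_nhdsWithin_of_mem_nhds (Metric.closedBall_mem_nhds z hε), _, subset_rfl,
        Metric.isClosed_closedBall.measurableSet, Metric.isBounded_closedBall, h⟩
  have := hU μ inferInstance
  rwa [Measure.restrict_eq_self_of_ae_mem (hμ.mono fun z hz => hKU hz)] at this

end ParametricIntegral

/-- The realization of a network with analytic activation depends analytically on any parameter
on which its weights, biases and input depend analytically. -/
theorem analyticAt_netRealization {V : Type*} [NormedAddCommGroup V] [NormedSpace ℝ V]
    {Narch : ℕ → ℕ} {ρ : ℝ → ℝ} (hρ : ∀ x, AnalyticAt ℝ ρ x)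
    {A : V → (ℓ : ℕ) → Fin (Narch (ℓ + 1)) → Fin (Narch ℓ) → ℝ}
    {b : V → (ℓ : ℕ) → Fin (Narch (ℓ + 1)) → ℝ} {x : V → Fin (Narch 0) → ℝ} {v : V}
    (hA : ∀ ℓ i j, AnalyticAt ℝ (fun v => A v ℓ i j) v)
    (hb : ∀ ℓ i, AnalyticAt ℝ (fun v => b v ℓ i) v) (hx : AnalyticAt ℝ x v) (k : ℕ) :
    AnalyticAt ℝ (fun v => netRealization Narch ρ (A v) (b v) k (x v)) v := by
  induction k with
  | zero => exact hx
  | succ k ih =>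
    refine analyticAt_pi_iff.2 fun i => ?_
    simp only [netRealization]
    refine (Finset.analyticAt_fun_sum _ fun j _ => (hA k i j).mul ?_).add (hb k i)
    have ihj := analyticAt_pi_iff.1 ih j
    split_ifs
    · exact ihj
    · exact (hρ _).fun_comp ihj

/-- Dereich–Kassing, Theorem 3.
If the activation function `ρ` and the loss `𝓛` are analytic and the data
`X`, `Y` are compactly supported, then the target function
`Θ ↦ E[𝓛(𝓡_N(Θ, X), Y)]` is analytic. -/
theorem neural_network_target_function_analytic
    (L : ℕ) (hL : 1 ≤ L) (Narch : ℕ → ℕ) (ρ : ℝ → ℝ)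
    (hρ : ∀ x : ℝ, AnalyticAt ℝ ρ x)
    (𝓛 : (Fin (Narch L) → ℝ) × (Fin (Narch L) → ℝ) → ℝ)
    (h𝓛 : ∀ z, AnalyticAt ℝ 𝓛 z)
    {Ω : Type*} [MeasurableSpace Ω] (P : Measure Ω) [IsProbabilityMeasure P]
    (X : Ω → (Fin (Narch 0) → ℝ)) (Y : Ω → (Fin (Narch L) → ℝ))
    (hX : Measurable X) (hY : Measurable Y)
    (KX : Set (Fin (Narch 0) → ℝ)) (hKX : IsCompact KX) (hXsupp : ∀ᵐ ω ∂P, X ω ∈ KX)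
    (KY : Set (Fin (Narch L) → ℝ)) (hKY : IsCompact KY) (hYsupp : ∀ᵐ ω ∂P, Y ω ∈ KY) :
    ∀ Θ : Π ℓ : Fin L, ((Fin (Narch (ℓ.1 + 1)) → Fin (Narch ℓ.1) → ℝ) ×
            (Fin (Narch (ℓ.1 + 1)) → ℝ)),
      AnalyticAt ℝ (fun Θ' : Π ℓ : Fin L, ((Fin (Narch (ℓ.1 + 1)) → Fin (Narch ℓ.1) → ℝ) ×
            (Fin (Narch (ℓ.1 + 1)) → ℝ)) =>
        ∫ ω, 𝓛 (netRealization Narch ρ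
          (fun ℓ => if h : ℓ < L then (Θ' ⟨ℓ, h⟩).1 else 0)
          (fun ℓ => if h : ℓ < L then (Θ' ⟨ℓ, h⟩).2 else 0)
          L (X ω), Y ω) ∂P) Θ := by
  intro Θ
  have hG : ∀ v : (Π ℓ : Fin L, ((Fin (Narch (ℓ.1 + 1)) → Fin (Narch ℓ.1) → ℝ) ×
      (Fin (Narch (ℓ.1 + 1)) → ℝ))) × ((Fin (Narch 0) → ℝ) × (Fin (Narch L) → ℝ)),
      AnalyticAt ℝ (fun v => 𝓛 (netRealization Narch ρ
        (fun ℓ => if h : ℓ < L then (v.1 ⟨ℓ, h⟩).1 else 0)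
        (fun ℓ => if h : ℓ < L then (v.1 ⟨ℓ, h⟩).2 else 0) L v.2.1, v.2.2)) v := by
    intro v
    have hΘ (ℓ : Fin L) := analyticAt_pi_iff.1 (analyticAt_fst (𝕜 := ℝ) (p := v)) ℓ
    refine (h𝓛 _).fun_comp (AnalyticAt.prod (analyticAt_netRealization hρ (fun ℓ i j => ?_)
      (fun ℓ i => ?_) (analyticAt_fst.fun_comp analyticAt_snd) L)
      (analyticAt_snd.fun_comp analyticAt_snd))
    · by_cases h : ℓ < L
      · simp only [h, dite_true]
        exact analyticAt_pi_iff.1 (analyticAt_pi_iff.1 (analyticAt_fst.fun_comp (hΘ ⟨ℓ, h⟩)) i) j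
      · simpa only [h, dite_false] using analyticAt_const
    · by_cases h : ℓ < L
      · simp only [h, dite_true]
        exact analyticAt_pi_iff.1 (analyticAt_snd.fun_comp (hΘ ⟨ℓ, h⟩)) i
      · simpa only [h, dite_false] using analyticAt_const
  have hZ : Measurable fun ω => (X ω, Y ω) := hX.prodMk hY
  have hcont := continuous_iff_continuousAt.2 fun v => (hG v).continuousAt
  have := Measure.isProbabilityMeasure_map (μ := P) hZ.aemeasurable
  have key := analyticAt_integral_of_isCompact hG (hKX.prod hKY) (μ := P.map fun ω => (X ω, Y ω))
    ((ae_map_iff hZ.aemeasurable (hKX.prod hKY).measurableSet).2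
      (by filter_upwards [hXsupp, hYsupp] with ω h₁ h₂ using ⟨h₁, h₂⟩)) Θ
  refine key.congr (Eventually.of_forall fun Θ' => ?_)
  exact integral_map hZ.aemeasurable
    (hcont.comp (Continuous.prodMk_right Θ')).aestronglyMeasurable
end

section
/- Let (M_n)_{n∈ℕ₀} be an ℝ^d-valued martingale with respect to a filtration (𝓕_n) on a probability space, and let β ∈ [1, 2]. If Σ_{n∈ℕ} E[|M_n − M_{n−1}|^β] < ∞, then (M_n) converges almost surely. -/
open MeasureTheory Filter

/-- Second-order bound for the function `x ↦ √(1 + x²)`, with a remainder that is controlled by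
every power of the increment with exponent in `[1, 2]`. -/
lemma sqrt_one_add_sq_add_le {β : ℝ} (hβ1 : 1 ≤ β) (hβ2 : β ≤ 2) (x h : ℝ) :
    √(1 + (x + h) ^ 2) ≤ √(1 + x ^ 2) + x / √(1 + x ^ 2) * h + 2 * |h| ^ β := by
  set a := √(1 + x ^ 2)
  have ha2 : a ^ 2 = 1 + x ^ 2 := Real.sq_sqrt (by positivity)
  have ha1 : 1 ≤ a := Real.one_le_sqrt.2 (by nlinarith [sq_nonneg x])
  have hxa : |x| ≤ a := Real.abs_le_sqrt (by linarith)
  have hgh : |x / a * h| ≤ |h| := by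
    rw [abs_mul, abs_div, abs_of_pos (by linarith : 0 < a)]
    exact mul_le_of_le_one_left (abs_nonneg h) ((div_le_one (by linarith)).2 hxa)
  have hg : x / a * a = x := div_mul_cancel₀ x (by linarith)
  rcases le_total |h| 1 with h1 | h1
  · have hpow : |h| ^ (2 : ℝ) ≤ |h| ^ β := by
      rcases (abs_nonneg h).eq_or_lt with h0 | h0
      · rw [← h0, Real.zero_rpow two_ne_zero, Real.zero_rpow (by linarith)]
      · exact Real.rpow_le_rpow_of_exponent_ge h0 h1 hβ2
    rw [Real.rpow_two, sq_abs] at hpow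
    set b := √(1 + (x + h) ^ 2)
    have hb2 : b ^ 2 = 1 + (x + h) ^ 2 := Real.sq_sqrt (by positivity)
    have hb : b ≤ a + x / a * h + h ^ 2 := by
      refine le_of_mul_le_mul_left ?_ (by linarith : 0 < a)
      have hga : a * (x / a * h) = x * h := by rw [← mul_assoc, mul_comm a, hg]
      nlinarith [sq_nonneg (b - a), mul_le_mul_of_nonneg_right ha1 (sq_nonneg h)]
    linarith [sq_nonneg h]
  · have hpow : |h| ^ (1 : ℝ) ≤ |h| ^ β := Real.rpow_le_rpow_of_exponent_le h1 hβ1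
    rw [Real.rpow_one] at hpow
    have hb : √(1 + (x + h) ^ 2) ≤ a + |h| := by
      refine Real.sqrt_le_iff.2 ⟨by positivity, ?_⟩
      have := abs_mul x h ▸ le_abs_self (x * h)
      nlinarith [mul_le_mul_of_nonneg_right hxa (abs_nonneg h), sq_abs h]
    linarith [neg_abs_le (x / a * h)]

/-- A martingale increment is orthogonal to every bounded function of the past. -/
lemma MeasureTheory.Martingale.integral_mul_sub_eq_zero {Ω : Type*} {m : MeasurableSpace Ω}
    {P : Measure Ω} [IsFiniteMeasure P] {ℱ : Filtration ℕ m} {X : ℕ → Ω → ℝ}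
    (hX : Martingale X ℱ P) (n : ℕ) {g : Ω → ℝ} (hg : StronglyMeasurable[ℱ n] g)
    (hint : Integrable (fun ω => g ω * (X (n + 1) ω - X n ω)) P) :
    ∫ ω, g ω * (X (n + 1) ω - X n ω) ∂P = 0 := by
  have hsub : P[fun ω => X (n + 1) ω - X n ω | ℱ n] =ᵐ[P] 0 := by
    filter_upwards [condExp_sub (hX.integrable (n + 1)) (hX.integrable n) (ℱ n),
      hX.condExp_ae_eq n.le_succ, hX.condExp_ae_eq (le_refl n)] with ω h1 h2 h3
    exact h1.trans (by simp [h2, h3])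
  have hmul := condExp_mul_of_stronglyMeasurable_left hg hint
    ((hX.integrable (n + 1)).sub (hX.integrable n))
  rw [← integral_condExp (ℱ.le n)]
  refine integral_eq_zero_of_ae (hmul.trans ?_)
  filter_upwards [hsub] with ω h
  simp [h]

/-- A real martingale whose increments have summable moments of order `β ∈ [1, 2]` converges
almost surely. -/
lemma MeasureTheory.Martingale.exists_ae_tendsto_of_tsum_lintegral_rpow_lt_top
    {Ω : Type*} {m : MeasurableSpace Ω} {P : Measure Ω} [IsFiniteMeasure P]
    {ℱ : Filtration ℕ m} {X : ℕ → Ω → ℝ} (hX : Martingale X ℱ P)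
    {β : ℝ} (hβ1 : 1 ≤ β) (hβ2 : β ≤ 2)
    (hsum : (∑' n : ℕ, ∫⁻ ω, ENNReal.ofReal (|X (n + 1) ω - X n ω| ^ β) ∂P) < ⊤) :
    ∀ᵐ ω ∂P, ∃ l : ℝ, Tendsto (fun n => X n ω) atTop (nhds l) := by
  set u : ℕ → ENNReal := fun n => ∫⁻ ω, ENNReal.ofReal (|X (n + 1) ω - X n ω| ^ β) ∂P with hu
  have hmeas (n : ℕ) : AEStronglyMeasurable (X n) P := (hX.integrable n).aestronglyMeasurable
  have hu_top (n : ℕ) : u n ≠ ⊤ := ENNReal.ne_top_of_tsum_ne_top hsum.ne n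
  have hΔ (n : ℕ) : Integrable (fun ω => X (n + 1) ω - X n ω) P :=
    (hX.integrable (n + 1)).sub (hX.integrable n)
  have hpm (n : ℕ) : AEStronglyMeasurable (fun ω => |X (n + 1) ω - X n ω| ^ β) P :=
    ((hΔ n).aemeasurable.abs.pow_const β).aestronglyMeasurable
  have hpn (n : ℕ) : 0 ≤ᵐ[P] fun ω => |X (n + 1) ω - X n ω| ^ β := ae_of_all _ fun ω => by
    positivity
  have hpow (n : ℕ) : Integrable (fun ω => |X (n + 1) ω - X n ω| ^ β) P :=
    (lintegral_ofReal_ne_top_iff_integrable (hpm n) (hpn n)).1 (hu_top n)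
  have hφ (n : ℕ) : Integrable (fun ω => √(1 + X n ω ^ 2)) P := by
    refine ((integrable_const (1 : ℝ)).add (hX.integrable n).abs).mono'
      (((hX.integrable n).aemeasurable.pow_const 2).const_add 1).sqrt.aestronglyMeasurable
      (ae_of_all _ fun ω => ?_)
    rw [Real.norm_of_nonneg (Real.sqrt_nonneg _)]
    refine Real.sqrt_le_iff.2 ⟨by simp only [Pi.add_apply]; positivity, ?_⟩
    simp only [Pi.add_apply]
    nlinarith [sq_abs (X n ω), abs_nonneg (X n ω)]
  have hgm (n : ℕ) : StronglyMeasurable[ℱ n] (fun ω => X n ω / √(1 + X n ω ^ 2)) := by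
    have := (hX.stronglyAdapted n).measurable
    exact (this.div ((this.pow_const 2).const_add 1).sqrt).stronglyMeasurable
  have hgb (x : ℝ) : ‖x / √(1 + x ^ 2)‖ ≤ 1 := by
    rw [norm_div, Real.norm_of_nonneg (Real.sqrt_nonneg _)]
    exact div_le_one_of_le₀ (Real.abs_le_sqrt (by linarith)) (Real.sqrt_nonneg _)
  have hgi (n : ℕ) :
      Integrable (fun ω => X n ω / √(1 + X n ω ^ 2) * (X (n + 1) ω - X n ω)) P :=
    (hΔ n).bdd_mul ((hgm n).mono (ℱ.le n)).aestronglyMeasurable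
      (ae_of_all _ fun ω => hgb (X n ω))
  have hstep (n : ℕ) :
      ∫ ω, √(1 + X (n + 1) ω ^ 2) ∂P ≤ ∫ ω, √(1 + X n ω ^ 2) ∂P + 2 * (u n).toReal := by
    have hle := integral_mono (hφ (n + 1)) (((hφ n).add (hgi n)).add ((hpow n).const_mul 2))
      fun ω => by
        simpa using sqrt_one_add_sq_add_le hβ1 hβ2 (X n ω) (X (n + 1) ω - X n ω)
    rw [integral_add' ((hφ n).add (hgi n)) ((hpow n).const_mul 2), integral_add' (hφ n) (hgi n),
      hX.integral_mul_sub_eq_zero n (hgm n) (hgi n), integral_const_mul,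
      integral_eq_lintegral_of_nonneg_ae (hpn n) (hpm n)] at hle
    simpa using hle
  have hbound (n : ℕ) : ∫ ω, √(1 + X n ω ^ 2) ∂P ≤
      ∫ ω, √(1 + X 0 ω ^ 2) ∂P + 2 * ∑ k ∈ Finset.range n, (u k).toReal := by
    induction n with
    | zero => simp
    | succ n ih => rw [Finset.sum_range_succ]; linarith [hstep n]
  have hsumm : Summable fun k => (u k).toReal := ENNReal.summable_toReal hsum.ne
  refine hX.submartingale.exists_ae_tendsto_of_bdd
    (R := (∫ ω, √(1 + X 0 ω ^ 2) ∂P + 2 * ∑' k, (u k).toReal).toNNReal) fun n => ?_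
  rw [eLpNorm_one_eq_lintegral_enorm, ← ofReal_integral_norm_eq_lintegral_enorm (hX.integrable n)]
  refine ENNReal.ofReal_le_ofReal ?_
  calc ∫ ω, ‖X n ω‖ ∂P ≤ ∫ ω, √(1 + X n ω ^ 2) ∂P :=
        integral_mono (hX.integrable n).norm (hφ n) fun ω => Real.abs_le_sqrt (by linarith)
    _ ≤ _ := hbound n
    _ ≤ _ := by
        gcongr
        exact hsumm.sum_le_tsum _ fun k _ => ENNReal.toReal_nonneg

/-- The image of a martingale under a continuous linear map is a martingale. -/
lemma MeasureTheory.Martingale.continuousLinearMap_comp {Ω ι E F : Type*} [Preorder ι]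
    {m : MeasurableSpace Ω} {P : Measure Ω} {ℱ : Filtration ι m}
    [NormedAddCommGroup E] [NormedSpace ℝ E] [CompleteSpace E]
    [NormedAddCommGroup F] [NormedSpace ℝ F] [CompleteSpace F]
    {M : ι → Ω → E} (hM : Martingale M ℱ P) (T : E →L[ℝ] F) :
    Martingale (fun n ω => T (M n ω)) ℱ P := by
  refine ⟨fun n => T.continuous.comp_stronglyMeasurable (hM.stronglyAdapted n), fun i j hij => ?_⟩
  filter_upwards [T.comp_condExp_comm (hM.integrable j) (m := ℱ i), hM.condExp_ae_eq hij]
    with ω h1 h2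
  rw [← h2]
  exact h1.symm

/-- Dereich–Kassing, Lemma A.1.
A (vector-valued) martingale `M` with `∑ₙ E[|Mₙ - Mₙ₋₁|^β] < ∞` for some
`β ∈ [1, 2]` converges almost surely. -/
theorem martingale_converges_of_summable_increment_moments
    {Ω : Type*} {m : MeasurableSpace Ω} {P : Measure Ω} [IsProbabilityMeasure P]
    (ℱ : Filtration ℕ m) {d : ℕ}
    (M : ℕ → Ω → EuclideanSpace ℝ (Fin d))
    (hM : Martingale M ℱ P)
    (β : ℝ) (hβ1 : 1 ≤ β) (hβ2 : β ≤ 2)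
    (hsum : (∑' n : ℕ, ∫⁻ ω, ENNReal.ofReal (‖M (n + 1) ω - M n ω‖ ^ β) ∂P) < ⊤) :
    ∀ᵐ ω ∂P, ∃ l : EuclideanSpace ℝ (Fin d),
      Tendsto (fun n => M n ω) atTop (nhds l) := by
  have hcoord (i : Fin d) : ∀ᵐ ω ∂P, ∃ l : ℝ, Tendsto (fun n => M n ω i) atTop (nhds l) := by
    refine (hM.continuousLinearMap_comp
      (EuclideanSpace.proj i)).exists_ae_tendsto_of_tsum_lintegral_rpow_lt_top hβ1 hβ2
      (lt_of_le_of_lt (ENNReal.tsum_le_tsum fun n => lintegral_mono fun ω => ?_) hsum)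
    refine ENNReal.ofReal_le_ofReal (Real.rpow_le_rpow (abs_nonneg _) ?_ (by linarith))
    exact PiLp.norm_apply_le (M (n + 1) ω - M n ω) i
  filter_upwards [ae_all_iff.2 hcoord] with ω hω
  choose l hl using hω
  exact ⟨WithLp.toLp 2 l, ((PiLp.continuous_toLp 2 _).tendsto l).comp (tendsto_pi_nhds.2 hl)⟩
end
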